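/- 1 + Σ_{n≥1} ((1/2)_n³/(1)_n³)(6n+1)(-1/8)^n = 2√2/π. -/

import Mathlib

open MeasureTheory Real Filter

/-- Pochhammer symbol `(x)_n`. -/
noncomputable def poch (x : ℝ) (n : ℕ) : ℝ := ∏ i ∈ Finset.range n, (x + i)

/-- Complete elliptic integral of the first kind. -/
noncomputable def K (k : ℝ) : ℝ :=
  ∫ θ in Set.Ioo 0 (Real.pi / 2), 1 / Real.sqrt (1 - k ^ 2 * Real.sin θ ^ 2)

/-- `K` as a function of the squared modulus, via the hypergeometric series
`K(k) = (π/2) ₂F₁(1/2,1/2;1;k²)`. -/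
noncomputable def Ksq (m : ℝ) : ℝ :=
  (Real.pi / 2) * ∑' n : ℕ, poch (1/2) n ^ 2 / poch 1 n ^ 2 * m ^ n

/-- Legendre polynomial `P_n(x)`. -/
noncomputable def P (n : ℕ) (x : ℝ) : ℝ :=
  (1 / 2 ^ n) * ∑ k ∈ Finset.range (n + 1), (n.choose k : ℝ) ^ 2 * (x - 1) ^ (n - k) * (x + 1) ^ k

theorem poch_succ (x : ℝ) (n : ℕ) : poch x (n + 1) = poch x n * (x + n) :=
  Finset.prod_range_succ _ _

theorem poch_pos {x : ℝ} (hx : 0 < x) (n : ℕ) : 0 < poch x n :=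
  Finset.prod_pos fun i _ => by positivity

theorem poch_one (n : ℕ) : poch 1 n = n.factorial := by
  induction n with
  | zero => simp [poch]
  | succ n ih => rw [poch_succ, ih, Nat.factorial_succ]; push_cast; ring

theorem poch_half (n : ℕ) :
    poch (1 / 2) n = (2 * n).factorial / (4 ^ n * n.factorial) := by
  induction n with
  | zero => simp [poch]
  | succ n ih =>
    rw [poch_succ, ih, show 2 * (n + 1) = 2 * n + 1 + 1 by ring, Nat.factorial_succ,
      Nat.factorial_succ, Nat.factorial_succ]
    push_cast
    field_simp
    ring

/-- The hypergeometric term of a one-parameter deformation of the series, which is recovered at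
`k = 0`. -/
noncomputable def wzTerm (k n : ℕ) : ℝ :=
  poch (1 / 2) n ^ 2 * poch (1 / 2) (2 * k + n) /
    (n.factorial * (n + k).factorial ^ 2 * 4 ^ k) * (-1 / 8) ^ n

theorem wzTerm_succ_right (k n : ℕ) :
    wzTerm k (n + 1) =
      -((n + 1 / 2) ^ 2 * (n + 1 / 2 + 2 * k) / (8 * (n + 1) * (n + 1 + k) ^ 2)) * wzTerm k n := by
  unfold wzTerm
  rw [show 2 * k + (n + 1) = 2 * k + n + 1 by ring, show n + 1 + k = n + k + 1 by ring,
    poch_succ, poch_succ, Nat.factorial_succ, Nat.factorial_succ, pow_succ (-1 / 8 : ℝ)]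
  push_cast
  rw [show (n : ℝ) + 1 + k = n + k + 1 by ring]
  field_simp
  ring

theorem wzTerm_succ_left (k n : ℕ) :
    wzTerm (k + 1) n =
      (4 * k + 1 + 2 * n) * (4 * k + 3 + 2 * n) / (16 * (n + 1 + k) ^ 2) * wzTerm k n := by
  unfold wzTerm
  rw [show 2 * (k + 1) + n = 2 * k + n + 1 + 1 by ring, show n + (k + 1) = n + k + 1 by ring,
    poch_succ, poch_succ, Nat.factorial_succ]
  push_cast
  rw [show (n : ℝ) + 1 + k = n + k + 1 by ring]
  field_simp
  ring

/-- The Wilf–Zeilberger identity. -/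
theorem wzTerm_telescope (k n : ℕ) :
    wzTerm (k + 1) n * (6 * n + 4 * (k + 1 : ℕ) + 1) - wzTerm k n * (6 * n + 4 * k + 1) =
      4 * (n + 1 : ℕ) * wzTerm k (n + 1) - 4 * n * wzTerm k n := by
  rw [wzTerm_succ_left, wzTerm_succ_right]
  push_cast
  have : (n : ℝ) + 1 + k ≠ 0 := by positivity
  field_simp
  ring

theorem wzTerm_zero_pos (k : ℕ) : 0 < wzTerm k 0 := by
  have := poch_pos (x := 1 / 2) (by norm_num) (2 * k)
  simp only [wzTerm, poch, Finset.range_zero, Finset.prod_empty] at *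
  positivity

theorem abs_wzTerm_succ_le (k n : ℕ) : |wzTerm k (n + 1)| ≤ |wzTerm k n| * (1 / 4) := by
  rw [wzTerm_succ_right, abs_mul, abs_neg, abs_of_nonneg (by positivity), mul_comm]
  refine mul_le_mul_of_nonneg_left ?_ (abs_nonneg _)
  rw [div_le_iff₀ (by positivity)]
  have h₁ : ((n : ℝ) + 1 / 2) ^ 2 ≤ (n + 1) * (n + 1 + k) := by
    nlinarith [mul_nonneg (Nat.cast_nonneg (α := ℝ) n) (Nat.cast_nonneg (α := ℝ) k),
      Nat.cast_nonneg (α := ℝ) n, Nat.cast_nonneg (α := ℝ) k]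
  have h₂ : (n : ℝ) + 1 / 2 + 2 * k ≤ 2 * (n + 1 + k) := by
    linarith [Nat.cast_nonneg (α := ℝ) n]
  linarith [mul_le_mul h₁ h₂ (by positivity) (by positivity)]

theorem abs_wzTerm_add_le (k m n : ℕ) :
    |wzTerm k (n + m)| ≤ |wzTerm k m| * (1 / 4) ^ n := by
  induction n with
  | zero => simp
  | succ n ih =>
    rw [add_right_comm, pow_succ, ← mul_assoc]
    exact (abs_wzTerm_succ_le k (n + m)).trans (by gcongr)

theorem abs_wzTerm_le (k n : ℕ) : |wzTerm k n| ≤ wzTerm k 0 * (1 / 4) ^ n := by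
  simpa [abs_of_pos (wzTerm_zero_pos k)] using abs_wzTerm_add_le k 0 n

theorem abs_wzTerm_one_le (k : ℕ) : |wzTerm k 1| ≤ wzTerm k 0 / (k + 1) := by
  have hk := wzTerm_zero_pos k
  have h := wzTerm_succ_right k 0
  rw [zero_add] at h
  rw [h, abs_mul, abs_neg, abs_of_nonneg (by positivity), abs_of_pos hk, mul_comm,
    div_eq_mul_inv (wzTerm k 0)]
  refine mul_le_mul_of_nonneg_left ?_ hk.le
  rw [← one_div, div_le_div_iff₀ (by positivity) (by positivity)]
  push_cast
  nlinarith [Nat.cast_nonneg (α := ℝ) k]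

theorem summable_linear_mul_geometric (a b : ℝ) :
    Summable fun n : ℕ => (a * n + b) * (1 / 4 : ℝ) ^ n := by
  have h₁ := (summable_pow_mul_geometric_of_norm_lt_one 1
    (show ‖(1 / 4 : ℝ)‖ < 1 by norm_num)).mul_left a
  have h₂ := (summable_geometric_of_lt_one (show (0 : ℝ) ≤ 1 / 4 by norm_num)
    (by norm_num)).mul_left b
  exact (h₁.add h₂).congr fun n => by ring

theorem summable_wzTerm_mul (k : ℕ) :
    Summable fun n : ℕ => wzTerm k n * (6 * n + 4 * k + 1) := by
  refine .of_norm_bounded ((summable_linear_mul_geometric 6 (4 * k + 1)).mul_left (wzTerm k 0))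
    fun n => ?_
  rw [norm_mul, Real.norm_eq_abs, Real.norm_eq_abs, abs_of_nonneg (a := 6 * (n : ℝ) + 4 * k + 1)
    (by positivity)]
  calc _ ≤ wzTerm k 0 * (1 / 4) ^ n * (6 * n + 4 * k + 1) := by
        gcongr; exact abs_wzTerm_le k n
    _ = _ := by ring

theorem tendsto_mul_wzTerm (k : ℕ) :
    Tendsto (fun n : ℕ => 4 * n * wzTerm k n) atTop (nhds 0) := by
  refine squeeze_zero_norm (fun n => ?_)
    (((summable_linear_mul_geometric 4 0).mul_left (wzTerm k 0)).tendsto_atTop_zero)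
  rw [norm_mul, Real.norm_eq_abs, Real.norm_eq_abs, abs_of_nonneg (a := 4 * (n : ℝ))
    (by positivity)]
  calc _ ≤ 4 * (n : ℝ) * (wzTerm k 0 * (1 / 4) ^ n) := by
        gcongr; exact abs_wzTerm_le k n
    _ = _ := by ring

theorem tsum_wzTerm_mul_succ (k : ℕ) :
    ∑' n : ℕ, wzTerm (k + 1) n * (6 * n + 4 * (k + 1 : ℕ) + 1) =
      ∑' n : ℕ, wzTerm k n * (6 * n + 4 * k + 1) := by
  have h := ((summable_wzTerm_mul (k + 1)).hasSum.sub
    (summable_wzTerm_mul k).hasSum).tendsto_sum_nat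
  simp only [wzTerm_telescope, Finset.sum_range_sub (fun n : ℕ => 4 * (n : ℝ) * wzTerm k n)] at h
  have h' := (tendsto_mul_wzTerm k).sub_const (4 * ((0 : ℕ) : ℝ) * wzTerm k 0)
  have := tendsto_nhds_unique h h'
  simp only [Nat.cast_zero, mul_zero, zero_mul, sub_zero] at this
  linarith

theorem tsum_wzTerm_mul (k : ℕ) :
    ∑' n : ℕ, wzTerm k n * (6 * n + 4 * k + 1) =
      ∑' n : ℕ, wzTerm 0 n * (6 * n + 4 * (0 : ℕ) + 1) := by
  induction k with
  | zero => rfl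
  | succ k ih => rw [tsum_wzTerm_mul_succ, ih]

theorem sq_wzTerm_zero (k : ℕ) :
    (wzTerm k 0 * (4 * k + 1)) ^ 2 =
      (2 - 1 / (2 * k + 1)) / (Real.Wallis.W k * Real.Wallis.W (2 * k)) := by
  have h : poch (1 / 2) 0 = 1 := by simp [poch]
  have h₄ : (4 : ℝ) ^ k = (2 ^ k) ^ 2 := by rw [← pow_mul, mul_comm, pow_mul]; norm_num
  rw [wzTerm, h, add_zero, poch_half, Real.Wallis.W_eq_factorial_ratio,
    Real.Wallis.W_eq_factorial_ratio, zero_add, mul_comm 2 k, pow_mul (4 : ℝ), h₄,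
    show (2 : ℝ) ^ (4 * k) = (2 ^ k) ^ 4 by rw [← pow_mul, mul_comm],
    show (2 : ℝ) ^ (4 * (k * 2)) = (2 ^ k) ^ 8 by rw [← pow_mul]; congr 1; ring]
  push_cast
  simp only [Nat.factorial_zero, Nat.cast_one, pow_zero]
  field_simp
  ring

theorem tendsto_wzTerm_zero_mul :
    Tendsto (fun k : ℕ => wzTerm k 0 * (4 * k + 1)) atTop (nhds (2 * √2 / π)) := by
  have hW := Real.Wallis.tendsto_W_nhds_pi_div_two
  have h2 : Tendsto (fun k : ℕ => 2 * k) atTop atTop :=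
    tendsto_id.const_mul_atTop' two_pos
  have h0 : Tendsto (fun k : ℕ => 1 / (2 * (k : ℝ) + 1)) atTop (nhds 0) := by
    have := tendsto_one_div_add_atTop_nhds_zero_nat (𝕜 := ℝ).comp h2
    refine this.congr fun k => ?_
    simp
  have h := ((h0.const_sub 2).div (hW.mul (hW.comp h2)) (by positivity)).sqrt
  have hlim : √((2 - 0) / (π / 2 * (π / 2))) = 2 * √2 / π := by
    rw [show (2 - 0) / (π / 2 * (π / 2)) = (2 * √2 / π) ^ 2 by
      rw [div_pow, mul_pow, Real.sq_sqrt (by norm_num)]; field_simp; norm_num]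
    exact Real.sqrt_sq (by positivity)
  rw [hlim] at h
  refine h.congr fun k => ?_
  have := wzTerm_zero_pos k
  simp only [Pi.div_apply, Function.comp_apply]
  rw [← sq_wzTerm_zero, Real.sqrt_sq (by positivity)]

theorem tendsto_wzTerm_zero : Tendsto (fun k : ℕ => wzTerm k 0) atTop (nhds 0) := by
  have h : Tendsto (fun k : ℕ => 4 * (k : ℝ) + 1) atTop atTop :=
    tendsto_atTop_add_const_right _ _ (tendsto_natCast_atTop_atTop.const_mul_atTop (by norm_num))
  refine (tendsto_wzTerm_zero_mul.div_atTop h).congr fun k => ?_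
  exact mul_div_cancel_right₀ _ (by positivity)

theorem abs_tsum_wzTerm_mul_sub_le (k : ℕ) :
    |∑' n : ℕ, wzTerm k n * (6 * n + 4 * k + 1) - wzTerm k 0 * (4 * k + 1)| ≤
      wzTerm k 0 * ∑' n : ℕ, (6 * n + 7) * (1 / 4 : ℝ) ^ n := by
  rw [(summable_wzTerm_mul k).tsum_eq_zero_add, ← tsum_mul_left]
  simp only [Nat.cast_zero, mul_zero, zero_add, add_sub_cancel_left]
  rw [← Real.norm_eq_abs]
  refine tsum_of_norm_bounded ((summable_linear_mul_geometric 6 7).mul_left _).hasSum fun n => ?_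
  rw [norm_mul, Real.norm_eq_abs, Real.norm_eq_abs,
    abs_of_nonneg (a := 6 * ((n + 1 : ℕ) : ℝ) + 4 * k + 1) (by positivity)]
  have hk := wzTerm_zero_pos k
  calc _ ≤ wzTerm k 0 * (1 / 4) ^ n / (k + 1) * ((6 * n + 7) * (k + 1)) := by
        have h : |wzTerm k (n + 1)| ≤ wzTerm k 0 * (1 / 4) ^ n / (k + 1) := by
          refine (abs_wzTerm_add_le k 1 n).trans ?_
          rw [mul_div_right_comm]
          gcongr
          exact abs_wzTerm_one_le k
        refine mul_le_mul h ?_ (by positivity) (by positivity)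
        push_cast
        nlinarith [mul_nonneg (Nat.cast_nonneg (α := ℝ) n) (Nat.cast_nonneg (α := ℝ) k),
          Nat.cast_nonneg (α := ℝ) k]
    _ = _ := by field_simp

theorem tsum_wzTerm_zero_mul :
    ∑' n : ℕ, wzTerm 0 n * (6 * n + 4 * (0 : ℕ) + 1) = 2 * √2 / π := by
  have h := tendsto_wzTerm_zero.mul_const (∑' n : ℕ, (6 * n + 7) * (1 / 4 : ℝ) ^ n)
  rw [zero_mul] at h
  have h' := squeeze_zero_norm (f := fun k : ℕ =>
    ∑' n : ℕ, wzTerm k n * (6 * n + 4 * k + 1) - wzTerm k 0 * (4 * k + 1))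
    abs_tsum_wzTerm_mul_sub_le h
  simp only [tsum_wzTerm_mul] at h'
  have := h'.add tendsto_wzTerm_zero_mul
  simp only [sub_add_cancel, zero_add] at this
  exact tendsto_nhds_unique tendsto_const_nhds this

theorem stmt15 :
    HasSum (fun n : ℕ => poch (1/2) n ^ 3 / poch 1 n ^ 3 * (6 * n + 1) * (-1/8 : ℝ) ^ n)
      (2 * Real.sqrt 2 / Real.pi) := by
  rw [← tsum_wzTerm_zero_mul]
  convert (summable_wzTerm_mul 0).hasSum using 2 with n
  rw [wzTerm, poch_one]
  simp only [mul_zero, zero_add, add_zero, pow_zero, mul_one, Nat.cast_zero]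
  field_simp
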